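/- Let p be a prime with p ≡ 1 (mod 3). Then Σ_{k=0}^{p−1} ( C(2k,k)·C(3k,k)/27^k ) · p/(3k + 1) ≡ C(2(p−1)/3, (p−1)/3) (mod p²). -/

import Mathlib

/-- A rational number is a `p`-integer if its denominator (in lowest terms)
is not divisible by `p`. -/
def isPInt (p : ℕ) (x : ℚ) : Prop := ¬ p ∣ x.den

/-- For `p`-integers `u, v`, `u ≡ v (mod p^k)` means `(u - v)/p^k` is a `p`-integer. -/
def pCong (p k : ℕ) (u v : ℚ) : Prop := isPInt p ((u - v) / (p : ℚ) ^ k)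

open Finset

/-- The ring of rational `p`-integers. -/
def pIntegers (p : ℕ) (hp : p.Prime) : Subring ℚ where
  carrier := {x | isPInt p x}
  mul_mem' {a b} ha hb h :=
    (hp.dvd_mul.1 (h.trans (Rat.mul_den_dvd a b))).elim ha hb
  add_mem' {a b} ha hb h :=
    (hp.dvd_mul.1 (h.trans (Rat.add_den_dvd a b))).elim ha hb
  one_mem' := hp.one_lt.ne' ∘ Nat.dvd_one.1
  zero_mem' := hp.one_lt.ne' ∘ Nat.dvd_one.1
  neg_mem' {a} ha := by simpa [isPInt] using ha

lemma inv_natCast_mem_pIntegers {p : ℕ} (hp : p.Prime) {m : ℕ} (hm : ¬ p ∣ m) :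
    (m : ℚ)⁻¹ ∈ pIntegers p hp := by
  have h0 : m ≠ 0 := by rintro rfl; simp at hm
  change ¬ p ∣ (m : ℚ)⁻¹.den
  rwa [Rat.inv_natCast_den_of_pos (Nat.pos_of_ne_zero h0)]

/-- Congruence modulo `q` of elements of a subring `R` of `ℚ`. -/
def CongMod (R : Subring ℚ) (q x y : ℚ) : Prop := ∃ z ∈ R, x - y = q * z

lemma CongMod.mul {R : Subring ℚ} {q x y x' y' : ℚ} (h : CongMod R q x y)
    (h' : CongMod R q x' y') (hy : y ∈ R) (hx' : x' ∈ R) :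
    CongMod R q (x * x') (y * y') := by
  obtain ⟨z, hz, e⟩ := h
  obtain ⟨z', hz', e'⟩ := h'
  exact ⟨z * x' + y * z', add_mem (mul_mem hz hx') (mul_mem hy hz'),
    by linear_combination x' * e + y * e'⟩

lemma CongMod.prod {R : Subring ℚ} {q : ℚ} {f g : ℕ → ℚ} {n : ℕ}
    (hf : ∀ i < n, f i ∈ R) (hg : ∀ i < n, g i ∈ R) (h : ∀ i < n, CongMod R q (f i) (g i)) :
    CongMod R q (∏ i ∈ range n, f i) (∏ i ∈ range n, g i) := by
  induction n with
  | zero => exact ⟨0, zero_mem _, by simp⟩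
  | succ n ih =>
    rw [prod_range_succ, prod_range_succ]
    exact (ih (fun i hi => hf i (by omega)) (fun i hi => hg i (by omega))
      (fun i hi => h i (by omega))).mul (h n (by omega))
      (prod_mem fun i hi => hg i (by have := mem_range.1 hi; omega)) (hf n (by omega))

lemma CongMod.sum {R : Subring ℚ} {q : ℚ} {f g : ℕ → ℚ} {s : Finset ℕ}
    (h : ∀ i ∈ s, CongMod R q (f i) (g i)) :
    CongMod R q (∑ i ∈ s, f i) (∑ i ∈ s, g i) := by
  choose! z hz e using h
  exact ⟨∑ i ∈ s, z i, sum_mem hz, by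
    rw [← sum_sub_distrib, mul_sum]; exact sum_congr rfl e⟩

/-- Coefficients of the shifted Legendre polynomial of degree `n`. -/
def legendreCoeff (n k : ℕ) : ℚ := (-1) ^ k * (n.choose k : ℚ) * ((n + k).choose k : ℚ)

lemma legendreCoeff_eq_zero {n k : ℕ} (h : n < k) : legendreCoeff n k = 0 := by
  simp [legendreCoeff, Nat.choose_eq_zero_of_lt h]

lemma legendreCoeff_succ_right (n k : ℕ) :
    legendreCoeff n (k + 1) * ((k : ℚ) + 1) ^ 2 =
      legendreCoeff n k * (((k : ℚ) - n) * ((n : ℚ) + k + 1)) := by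
  have h1 : (n.choose (k + 1) : ℚ) * (k + 1) = n.choose k * ((n : ℚ) - k) := by
    rcases le_or_gt k n with h | h
    · have := Nat.choose_succ_right_eq n k
      rw [← Nat.cast_sub h]; exact_mod_cast this
    · simp [Nat.choose_eq_zero_of_lt h, Nat.choose_eq_zero_of_lt (h.trans k.lt_succ_self)]
  have h2 : ((n + (k + 1)).choose (k + 1) : ℚ) * (k + 1) = (n + k).choose k * ((n : ℚ) + k + 1) := by
    have := Nat.add_one_mul_choose_eq (n + k) k
    rw [← add_assoc]
    have h : ((n + k + 1 : ℕ) : ℚ) * (n + k).choose k = (n + k + 1).choose (k + 1) * (k + 1 : ℕ) := by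
      exact_mod_cast this
    push_cast at h
    linarith
  unfold legendreCoeff
  rw [pow_succ]
  linear_combination (-(-1) ^ k * ((n + (k + 1)).choose (k + 1) : ℚ) * (k + 1)) * h1
    + (-(-1) ^ k * (n.choose k * ((n : ℚ) - k))) * h2

lemma sum_alternating_choose_mul_choose (n m : ℕ) :
    ∑ k ∈ range (m + 1), (-1 : ℚ) ^ k * ((n + 1).choose k : ℚ) * ((n + k).choose k : ℚ) =
      (-1) ^ m * (n.choose m : ℚ) * ((n + 1 + m).choose m : ℚ) := by
  induction m with
  | zero => simp
  | succ m ih =>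
    rw [sum_range_succ, ih]
    have e1 : ((n + 1).choose (m + 1) : ℚ) = n.choose m + n.choose (m + 1) := by
      exact_mod_cast Nat.choose_succ_succ n m
    have e2 : ((n + 1 + (m + 1)).choose (m + 1) : ℚ)
        = (n + 1 + m).choose m + (n + 1 + m).choose (m + 1) := by
      exact_mod_cast Nat.choose_succ_succ (n + 1 + m) m
    have e3 : ((n + 1 : ℕ) : ℚ) * n.choose m = (n + 1).choose (m + 1) * (m + 1 : ℕ) := by
      exact_mod_cast Nat.add_one_mul_choose_eq n m
    have e4 : ((n + 1 + m).choose (m + 1) : ℚ) * (m + 1 : ℕ)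
        = (n + 1 + m).choose m * (n + 1 : ℕ) := by
      have := Nat.choose_succ_right_eq (n + 1 + m) m
      rw [Nat.add_sub_cancel] at this
      exact_mod_cast this
    have e5 : ((n + 1).choose (m + 1) : ℚ) * (n + 1 + m).choose m
        = n.choose m * (n + 1 + m).choose (m + 1) := by
      have : ((m + 1 : ℕ) : ℚ) ≠ 0 := by positivity
      apply mul_right_cancel₀ this
      linear_combination (-((n + 1 + m).choose m : ℚ)) * e3 - (n.choose m : ℚ) * e4
    rw [show n + (m + 1) = n + 1 + m by ring, e2, pow_succ]
    rw [e1] at e5 ⊢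
    linear_combination (-1 : ℚ) ^ m * e5

lemma legendreCoeff_succ_left (n k : ℕ) (x : ℚ) :
    ((n : ℚ) + 1 + x) * legendreCoeff (n + 1) k - ((n : ℚ) + 1 - x) * legendreCoeff n k =
      2 * (x + k) * ((-1) ^ k * ((n + 1).choose k : ℚ) * ((n + k).choose k : ℚ)) := by
  have h1 : ((n : ℚ) + 1) * n.choose k = (n + 1).choose k * ((n : ℚ) + 1 - k) := by
    rcases le_or_gt k (n + 1) with h | h
    · have h1 : n.choose k * (n + 1) = (n + 1).choose k * (n + 1 - k) := Nat.choose_mul_succ_eq n k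
      have h2 : (n.choose k : ℚ) * (n + 1 : ℕ) = (n + 1).choose k * (n + 1 - k : ℕ) := by
        exact_mod_cast h1
      rw [Nat.cast_sub h] at h2
      push_cast at h2
      linarith
    · simp [Nat.choose_eq_zero_of_lt h, Nat.choose_eq_zero_of_lt (n.lt_succ_self.trans h)]
  have h2 : ((n : ℚ) + 1) * (n + 1 + k).choose k = (n + k).choose k * ((n : ℚ) + 1 + k) := by
    have h1 := Nat.choose_mul_succ_eq (n + k) k
    rw [show n + k + 1 - k = n + 1 by omega] at h1
    have h2 : ((n + k).choose k : ℚ) * (n + k + 1 : ℕ) = (n + k + 1).choose k * (n + 1 : ℕ) := by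
      exact_mod_cast h1
    rw [show n + 1 + k = n + k + 1 by ring]
    push_cast at h2
    linarith
  have h0 : (n : ℚ) + 1 ≠ 0 := by positivity
  apply mul_left_cancel₀ h0
  unfold legendreCoeff
  linear_combination (-1) ^ k * (((n : ℚ) + 1 + x) * (n + 1).choose k * h2
    - ((n : ℚ) + 1 - x) * (n + k).choose k * h1)

lemma sum_legendreCoeff_div {x : ℚ} (hx : 0 < x) (n : ℕ) :
    (∑ k ∈ range (n + 1), legendreCoeff n k / (x + k)) * ∏ j ∈ range (n + 1), (j + x) =
      ∏ j ∈ range n, ((j : ℚ) + 1 - x) := by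
  induction n with
  | zero => simp [legendreCoeff, hx.ne']
  | succ n ih =>
    have key : ((n : ℚ) + 1 + x) * (∑ k ∈ range (n + 2), legendreCoeff (n + 1) k / (x + k))
        = ((n : ℚ) + 1 - x) * ∑ k ∈ range (n + 1), legendreCoeff n k / (x + k) := by
      have h0 : ∑ k ∈ range (n + 1), legendreCoeff n k / (x + k)
          = ∑ k ∈ range (n + 2), legendreCoeff n k / (x + k) := by
        rw [sum_range_succ _ (n + 1), legendreCoeff_eq_zero n.lt_succ_self]; simp
      rw [h0, ← sub_eq_zero, mul_sum, mul_sum, ← sum_sub_distrib]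
      have h1 := sum_alternating_choose_mul_choose n (n + 1)
      rw [Nat.choose_succ_self] at h1
      calc _ = ∑ k ∈ range (n + 2),
            2 * ((-1 : ℚ) ^ k * ((n + 1).choose k : ℚ) * ((n + k).choose k : ℚ)) := by
            refine sum_congr rfl fun k _ => ?_
            have hk : x + k ≠ 0 := by positivity
            have := legendreCoeff_succ_left n k x
            field_simp
            linarith
        _ = 0 := by rw [← mul_sum, h1]; simp
    rw [prod_range_succ (fun j : ℕ => (j : ℚ) + x) (n + 1),
      prod_range_succ (fun j : ℕ => (j : ℚ) + 1 - x) n, ← ih]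
    push_cast
    linear_combination (∏ j ∈ range (n + 1), ((j : ℚ) + x)) * key

/-- The coefficients of the hypergeometric series `₂F₁(1/3, 2/3; 1; z)`. -/
def cubicCoeff (k : ℕ) : ℚ := ((2 * k).choose k : ℚ) * ((3 * k).choose k : ℚ) / 27 ^ k

lemma cubicCoeff_eq_factorial (k : ℕ) :
    cubicCoeff k = (3 * k).factorial / ((k.factorial : ℚ) ^ 3 * 27 ^ k) := by
  have h1 := Nat.choose_mul_factorial_mul_factorial (show k ≤ 2 * k by omega)
  have h2 := Nat.choose_mul_factorial_mul_factorial (show k ≤ 3 * k by omega)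
  rw [show 2 * k - k = k by omega] at h1
  rw [show 3 * k - k = 2 * k by omega, ← h1] at h2
  have hf : (k.factorial : ℚ) ≠ 0 := by exact_mod_cast k.factorial_ne_zero
  unfold cubicCoeff
  rw [← h2]
  push_cast
  field_simp

lemma cubicCoeff_succ (k : ℕ) :
    cubicCoeff (k + 1) * ((k : ℚ) + 1) ^ 2 =
      cubicCoeff k * (((k : ℚ) + 1 / 3) * ((k : ℚ) + 2 / 3)) := by
  have hf : (k.factorial : ℚ) ≠ 0 := by exact_mod_cast k.factorial_ne_zero
  have hk : (k : ℚ) + 1 ≠ 0 := by positivity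
  rw [cubicCoeff_eq_factorial, cubicCoeff_eq_factorial, show 3 * (k + 1) = 3 * k + 1 + 1 + 1 by ring]
  simp only [Nat.factorial_succ]
  push_cast
  field_simp
  ring

lemma cubicCoeff_mul_factorial_sq (n : ℕ) :
    cubicCoeff n * (n.factorial : ℚ) ^ 2 =
      (∏ j ∈ range n, ((j : ℚ) + 1 / 3)) * ∏ j ∈ range n, ((j : ℚ) + 2 / 3) := by
  induction n with
  | zero => simp [cubicCoeff]
  | succ n ih =>
    rw [prod_range_succ, prod_range_succ, Nat.factorial_succ]
    push_cast
    linear_combination (n.factorial : ℚ) ^ 2 * cubicCoeff_succ n +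
      ((n : ℚ) + 1 / 3) * ((n : ℚ) + 2 / 3) * ih

lemma inv_three_mem_pIntegers {p n : ℕ} (hp : p.Prime) (hn : p = 3 * n + 1) :
    (3 : ℚ)⁻¹ ∈ pIntegers p hp := by
  refine mod_cast inv_natCast_mem_pIntegers hp (m := 3) fun h => ?_
  obtain rfl := (Nat.prime_dvd_prime_iff_eq hp Nat.prime_three).1 h
  omega

lemma inv_mem_pIntegers_of_lt {p m : ℕ} (hp : p.Prime) (h0 : 0 < m) (h : m < p) :
    (m : ℚ)⁻¹ ∈ pIntegers p hp :=
  inv_natCast_mem_pIntegers hp (Nat.not_dvd_of_pos_of_lt h0 h)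

lemma inv_three_mul_add_one_mem_pIntegers {p n k : ℕ} (hp : p.Prime) (hn : p = 3 * n + 1)
    (hk : k < p) (hkn : k ≠ n) : (3 * (k : ℚ) + 1)⁻¹ ∈ pIntegers p hp := by
  have := inv_natCast_mem_pIntegers hp (m := 3 * k + 1) (by
    rintro ⟨c, hc⟩
    have : c < 3 := by
      by_contra! h
      have := Nat.mul_le_mul_left p h
      omega
    interval_cases c <;> omega)
  exact_mod_cast this

lemma cubicCoeff_cong_legendreCoeff {p n : ℕ} (hp : p.Prime) (hn : p = 3 * n + 1) {k : ℕ}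
    (hk : k < p) : CongMod (pIntegers p hp) p (cubicCoeff k) (legendreCoeff n k) := by
  have h3 := inv_three_mem_pIntegers hp hn
  have hL : ∀ k, legendreCoeff n k ∈ pIntegers p hp := fun k =>
    mul_mem (mul_mem (pow_mem (neg_mem (one_mem _)) _) (natCast_mem _ _)) (natCast_mem _ _)
  induction k with
  | zero => exact ⟨0, zero_mem _, by simp [cubicCoeff, legendreCoeff]⟩
  | succ k ih =>
    obtain ⟨z, hz, e⟩ := ih (by omega)
    have hi : ((k : ℚ) + 1)⁻¹ ∈ pIntegers p hp := by
      exact_mod_cast inv_mem_pIntegers_of_lt hp k.succ_pos hk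
    have hk0 : (k : ℚ) + 1 ≠ 0 := by positivity
    have hpn : (p : ℚ) = 3 * n + 1 := by exact_mod_cast hn
    refine ⟨(((k : ℚ) + 3⁻¹) * ((k : ℚ) + 2 * 3⁻¹) * z
      + legendreCoeff n k * ((p + 1) * 3⁻¹ ^ 2)) * ((k : ℚ) + 1)⁻¹ ^ 2, ?_, ?_⟩
    · have hkm := natCast_mem (pIntegers p hp) k
      have hpm := natCast_mem (pIntegers p hp) p
      have h2 : (2 : ℚ) ∈ pIntegers p hp := by exact_mod_cast natCast_mem (pIntegers p hp) 2
      exact mul_mem (add_mem (mul_mem (mul_mem (add_mem hkm h3) (add_mem hkm (mul_mem h2 h3))) hz)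
        (mul_mem (hL k) (mul_mem (add_mem hpm (one_mem _)) (pow_mem h3 _)))) (pow_mem hi _)
    · have h1 := cubicCoeff_succ k
      have h2 := legendreCoeff_succ_right n k
      rw [← mul_left_inj' (pow_ne_zero 2 hk0), inv_pow ((k : ℚ) + 1), mul_assoc, mul_assoc,
        inv_mul_cancel₀ (pow_ne_zero 2 hk0), hpn]
      rw [hpn] at e
      linear_combination h1 - h2 + ((k : ℚ) + 1 / 3) * ((k : ℚ) + 2 / 3) * e

lemma prod_add_one_third_cong {p n : ℕ} (hp : p.Prime) (hn : p = 3 * n + 1) (he : Even n) :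
    CongMod (pIntegers p hp) p (∏ j ∈ range n, ((j : ℚ) + 1 / 3)) n.factorial := by
  have h3 := inv_three_mem_pIntegers hp hn
  have hpn : (p : ℚ) = 3 * n + 1 := by exact_mod_cast hn
  have e1 : (n.factorial : ℚ) = ∏ j ∈ range n, ((j : ℚ) - n) := by
    rw [← prod_range_reflect, ← prod_range_add_one_eq_factorial]
    push_cast
    calc _ = (-1 : ℚ) ^ n * ∏ j ∈ range n, ((j : ℚ) + 1) := by rw [he.neg_one_pow, one_mul]
      _ = ∏ j ∈ range n, -((j : ℚ) + 1) := by rw [prod_neg, card_range]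
      _ = _ := prod_congr rfl fun j hj => by
        rw [Nat.cast_sub (by have := mem_range.1 hj; omega),
          Nat.cast_sub (by have := mem_range.1 hj; omega)]
        push_cast; ring
  rw [e1]
  refine CongMod.prod (fun i _ => ?_) (fun i _ => ?_) fun i _ => ⟨3⁻¹, h3, ?_⟩
  · rw [one_div]; exact add_mem (natCast_mem _ _) h3
  · exact sub_mem (natCast_mem _ _) (natCast_mem _ _)
  · rw [hpn]; ring

lemma CongMod.of_sq {R : Subring ℚ} {q x y : ℚ} (h : CongMod R q x y)
    (hsq : CongMod R (q ^ 2) (x ^ 2) (y ^ 2)) (hy : (2 * y)⁻¹ ∈ R) (h0 : y ≠ 0) :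
    CongMod R (q ^ 2) x y := by
  obtain ⟨w, hw, e⟩ := h
  obtain ⟨z, hz, e'⟩ := hsq
  refine ⟨(z - w ^ 2) * (2 * y)⁻¹, mul_mem (sub_mem hz (pow_mem hw _)) hy, ?_⟩
  field_simp
  linear_combination e' - (x - y + q * w) * e

lemma prod_add_two_thirds_cong {p n : ℕ} (hp : p.Prime) (hn : p = 3 * n + 1) :
    CongMod (pIntegers p hp) ((p : ℚ) ^ 2) (∏ j ∈ range n, ((j : ℚ) + 2 / 3))
      ((n + 1).ascFactorial n) := by
  have h3 := inv_three_mem_pIntegers hp hn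
  have hpn : (p : ℚ) = 3 * n + 1 := by exact_mod_cast hn
  have h23 : (2 / 3 : ℚ) ∈ pIntegers p hp := by
    rw [div_eq_mul_inv]; exact mul_mem (by exact_mod_cast natCast_mem (pIntegers p hp) 2) h3
  have hf (i : ℕ) : (i : ℚ) + 2 / 3 ∈ pIntegers p hp := add_mem (natCast_mem _ _) h23
  have hg (i : ℕ) : (n : ℚ) + 1 + i ∈ pIntegers p hp := by
    exact_mod_cast natCast_mem (pIntegers p hp) (n + 1 + i)
  have hlt : ∀ i ∈ range n, ¬ p ∣ n + 1 + i := fun i hi =>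
    Nat.not_dvd_of_pos_of_lt (by omega) (by have := mem_range.1 hi; omega)
  have hnd : ¬ p ∣ 2 * (n + 1).ascFactorial n := by
    rw [Nat.ascFactorial_eq_prod_range, hp.dvd_mul, hp.prime.dvd_finsetProd_iff]
    rintro (h | ⟨i, hi, h⟩)
    · have := Nat.le_of_dvd two_pos h
      have := hp.two_le
      omega
    · exact hlt i hi h
  refine CongMod.of_sq ?_ ?_ ?_ ?_
  · rw [Nat.ascFactorial_eq_prod_range]
    push_cast
    refine CongMod.prod (fun i _ => hf i) (fun i _ => hg i) fun i _ => ⟨-3⁻¹, neg_mem h3, ?_⟩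
    rw [hpn]; ring
  · have reflect_sq (f : ℕ → ℚ) : (∏ j ∈ range n, f j) ^ 2
        = ∏ j ∈ range n, f j * f (n - 1 - j) := by
      rw [prod_mul_distrib, prod_range_reflect, sq]
    rw [Nat.ascFactorial_eq_prod_range]
    push_cast
    rw [reflect_sq, reflect_sq]
    refine CongMod.prod (fun i _ => mul_mem (hf _) (hf _)) (fun i _ => mul_mem (hg _) (hg _))
      fun i hi => ⟨-(2 / 3 * 3⁻¹), neg_mem (mul_mem h23 h3), ?_⟩
    have : ((n - 1 - i : ℕ) : ℚ) = n - 1 - i := by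
      rw [Nat.cast_sub (by omega), Nat.cast_sub (by omega)]; simp
    rw [this, hpn]; ring
  · exact_mod_cast inv_natCast_mem_pIntegers hp hnd
  · exact_mod_cast (Nat.ascFactorial_pos _ _).ne'

lemma inv_prod_add_one_third_mem {p n : ℕ} (hp : p.Prime) (hn : p = 3 * n + 1) :
    (∏ j ∈ range n, ((j : ℚ) + 1 / 3))⁻¹ ∈ pIntegers p hp := by
  rw [← prod_inv_distrib]
  refine prod_mem fun j hj => ?_
  have hj := mem_range.1 hj
  have : ((j : ℚ) + 1 / 3)⁻¹ = 3 * (3 * (j : ℚ) + 1)⁻¹ := by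
    have : (3 * (j : ℚ) + 1) ≠ 0 := by positivity
    have : ((j : ℚ) + 1 / 3) ≠ 0 := by positivity
    field_simp
  rw [this]
  exact mul_mem (by exact_mod_cast natCast_mem (pIntegers p hp) 3)
    (inv_three_mul_add_one_mem_pIntegers hp hn (by omega) (by omega))

lemma sum_legendreCoeff_mul_div {p n : ℕ} (hn : p = 3 * n + 1) :
    ∑ k ∈ range p, legendreCoeff n k * ((p : ℚ) / (3 * (k : ℚ) + 1)) =
      (∏ j ∈ range n, ((j : ℚ) + 2 / 3)) / ∏ j ∈ range n, ((j : ℚ) + 1 / 3) := by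
  have h := sum_legendreCoeff_div (x := 1 / 3) (by norm_num) n
  have hA : ∏ j ∈ range n, ((j : ℚ) + 1 / 3) ≠ 0 := prod_ne_zero_iff.2 fun j _ => by positivity
  have hpn : (p : ℚ) = 3 * n + 1 := by exact_mod_cast hn
  have e1 : ∑ k ∈ range p, legendreCoeff n k * ((p : ℚ) / (3 * (k : ℚ) + 1))
      = ((n : ℚ) + 1 / 3) * ∑ k ∈ range (n + 1), legendreCoeff n k / (1 / 3 + k) := by
    rw [mul_sum]
    refine (sum_subset (range_subset_range.2 (by omega)) fun k _ hk => ?_).symm.trans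
      (sum_congr rfl fun k _ => ?_)
    · rw [legendreCoeff_eq_zero (by rw [mem_range] at hk; omega), zero_mul]
    · have : (3 * (k : ℚ) + 1) ≠ 0 := by positivity
      have : (1 / 3 + (k : ℚ)) ≠ 0 := by positivity
      rw [hpn]
      field_simp
      ring
  rw [e1, eq_div_iff hA]
  rw [prod_range_succ] at h
  rw [show ∏ j ∈ range n, ((j : ℚ) + 2 / 3) = ∏ j ∈ range n, ((j : ℚ) + 1 - 1 / 3) from
    prod_congr rfl fun j _ => by ring, ← h]
  ring

lemma sum_cubicCoeff_cong {p n : ℕ} (hp : p.Prime) (hn : p = 3 * n + 1) :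
    CongMod (pIntegers p hp) ((p : ℚ) ^ 2)
      (∑ k ∈ range p, cubicCoeff k * ((p : ℚ) / (3 * (k : ℚ) + 1)))
      ((∑ k ∈ range p, legendreCoeff n k * ((p : ℚ) / (3 * (k : ℚ) + 1)))
        + (cubicCoeff n - legendreCoeff n n)) := by
  have hpn : (p : ℚ) = 3 * n + 1 := by exact_mod_cast hn
  have hmem : n ∈ range p := mem_range.2 (by omega)
  have hne : (p : ℚ) ≠ 0 := by exact_mod_cast hp.ne_zero
  have hone : (p : ℚ) / (3 * (n : ℚ) + 1) = 1 := by rw [← hpn]; exact div_self hne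
  obtain ⟨z, hz, e⟩ : CongMod (pIntegers p hp) ((p : ℚ) ^ 2)
      (∑ k ∈ (range p).erase n, cubicCoeff k * ((p : ℚ) / (3 * (k : ℚ) + 1)))
      (∑ k ∈ (range p).erase n, legendreCoeff n k * ((p : ℚ) / (3 * (k : ℚ) + 1))) := by
    refine CongMod.sum fun k hk => ?_
    obtain ⟨hkn, hk⟩ := mem_erase.1 hk
    have hk := mem_range.1 hk
    obtain ⟨z, hz, e⟩ := cubicCoeff_cong_legendreCoeff hp hn hk
    refine ⟨z * (3 * (k : ℚ) + 1)⁻¹,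
      mul_mem hz (inv_three_mul_add_one_mem_pIntegers hp hn hk hkn), ?_⟩
    rw [div_eq_mul_inv]
    linear_combination (p : ℚ) * (3 * (k : ℚ) + 1)⁻¹ * e
  refine ⟨z, hz, ?_⟩
  rw [← add_sum_erase _ _ hmem, ← add_sum_erase _ _ hmem, hone]
  linear_combination e

lemma sum_cubicCoeff_cong_choose {p n : ℕ} (hp : p.Prime) (hn : p = 3 * n + 1) (he : Even n) :
    CongMod (pIntegers p hp) ((p : ℚ) ^ 2)
      (∑ k ∈ range p, cubicCoeff k * ((p : ℚ) / (3 * (k : ℚ) + 1))) ((2 * n).choose n) := by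
  obtain ⟨z, hz, e⟩ := sum_cubicCoeff_cong hp hn
  rw [sum_legendreCoeff_mul_div hn] at e
  obtain ⟨a, ha, ea⟩ := prod_add_one_third_cong hp hn he
  obtain ⟨b, hb, eb⟩ := prod_add_two_thirds_cong hp hn
  have ec := cubicCoeff_mul_factorial_sq n
  have hA := inv_prod_add_one_third_mem hp hn
  have hA0 : ∏ j ∈ range n, ((j : ℚ) + 1 / 3) ≠ 0 := prod_ne_zero_iff.2 fun j _ => by positivity
  have hf0 : (n.factorial : ℚ) ≠ 0 := by exact_mod_cast n.factorial_ne_zero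
  have hf : (n.factorial : ℚ)⁻¹ ∈ pIntegers p hp :=
    inv_natCast_mem_pIntegers hp (by rw [hp.dvd_factorial]; omega)
  have eP : ((n + 1).ascFactorial n : ℚ) = n.factorial * (2 * n).choose n := by
    rw [two_mul]; exact_mod_cast Nat.ascFactorial_eq_factorial_mul_choose n n
  have el : legendreCoeff n n = (2 * n).choose n := by
    simp [legendreCoeff, he.neg_one_pow, two_mul]
  have hC := natCast_mem (pIntegers p hp) ((2 * n).choose n)
  have hfm := natCast_mem (pIntegers p hp) n.factorial
  have hpm := natCast_mem (pIntegers p hp) p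
  have h2 : (2 : ℚ) ∈ pIntegers p hp := by exact_mod_cast natCast_mem (pIntegers p hp) 2
  rw [el] at e
  rw [eP] at eb
  generalize (∏ j ∈ range n, ((j : ℚ) + 1 / 3)) = A at *
  generalize (∏ j ∈ range n, ((j : ℚ) + 2 / 3)) = B at *
  generalize ((2 * n).choose n : ℚ) = C at *
  generalize (n.factorial : ℚ) = f at *
  have hB : B ∈ pIntegers p hp := by
    rw [show B = f * C + p ^ 2 * b by linear_combination eb]
    exact add_mem (mul_mem hfm hC) (mul_mem (pow_mem hpm _) hb)
  refine ⟨z + (2 * b * f⁻¹ + a ^ 2 * B * f⁻¹ ^ 2 * A⁻¹), add_mem hz (add_mem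
    (mul_mem (mul_mem h2 hb) hf)
    (mul_mem (mul_mem (mul_mem (pow_mem ha _) hB) (pow_mem hf _)) hA)), ?_⟩
  have ec' : cubicCoeff n = A * B / f ^ 2 := by rw [eq_div_iff (pow_ne_zero _ hf0), ec]
  have : B / A + cubicCoeff n - 2 * C
      = p ^ 2 * (2 * b * f⁻¹ + a ^ 2 * B * f⁻¹ ^ 2 * A⁻¹) := by
    rw [ec']
    field_simp
    linear_combination B * (A - f + p * a) * ea + 2 * A * f * eb
  linear_combination e + this

theorem stmt10 (p : ℕ) (hp : p.Prime) (hp3 : p % 3 = 1) :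
    pCong p 2
      (∑ k ∈ Finset.range p,
        ((2 * k).choose k : ℚ) * ((3 * k).choose k : ℚ) / 27 ^ k *
          ((p : ℚ) / (3 * (k : ℚ) + 1)))
      ((2 * (p - 1) / 3).choose ((p - 1) / 3) : ℚ) := by
  obtain ⟨n, hn⟩ : ∃ n, p = 3 * n + 1 := ⟨p / 3, by omega⟩
  have he : Even n := by
    have h2 : p ≠ 2 := by rintro rfl; omega
    obtain ⟨m, hm⟩ := hp.odd_of_ne_two h2
    exact Nat.even_iff.2 (by omega)
  obtain ⟨z, hz, e⟩ := sum_cubicCoeff_cong_choose hp hn he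
  have hp0 : (p : ℚ) ^ 2 ≠ 0 := pow_ne_zero _ (by exact_mod_cast hp.ne_zero)
  rw [show 2 * (p - 1) / 3 = 2 * n by omega, show (p - 1) / 3 = n by omega]
  change isPInt p (_ / _)
  unfold cubicCoeff at e
  rw [e, mul_div_cancel_left₀ _ hp0]
  exact hz
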